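/- Let g₁, g₂ ∈ ℚ[X] be polynomials such that g₂(p) ≠ 0 and 0 < g₁(p)/g₂(p) < 1/2 for every p ∈ (0,1), and write g(p) = g₁(p)/g₂(p). Then there exist disjoint context-free languages L₀, L₁ over the alphabet {0,1} such that L₀ ∪ L₁ has the prefix property and, for every p ∈ (0,1), P_p(L₀ ∪ L₁) = 1 and P_p(L₁) = (1 - √(1 - 2g(p))) / (2g(p)). -/

import Mathlib

/-- Probability of a word `w` under i.i.d. `p`-coin tosses. -/
noncomputable def wordProb (p : ℝ) (w : List Bool) : ℝ :=
  p ^ (w.count true) * (1 - p) ^ (w.count false)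

/-- Probability of a language under i.i.d. `p`-coin tosses. -/
noncomputable def langProb (p : ℝ) (L : Set (List Bool)) : ℝ :=
  ∑' w : L, wordProb p (w : List Bool)

/-- A language has the prefix property if no word of it is a proper prefix
of another word of it. -/
def PrefixFree (L : Set (List Bool)) : Prop :=
  ∀ u ∈ L, ∀ v ∈ L, u ≠ v → ¬ u <+: v

/-- `Yields R s w` says that the sentential form `s` can be rewritten to the word `w`
using the rules in `R`. -/
inductive Yields {T N : Type} (R : Finset (ContextFreeRule T N)) :
    List (Symbol T N) → List T → Prop
  | nil : Yields R [] []
  | terminal (t : T) {s : List (Symbol T N)} {w : List T} :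
      Yields R s w → Yields R (.terminal t :: s) (t :: w)
  | nonterminal {r : ContextFreeRule T N} {s : List (Symbol T N)} {u w : List T} :
      r ∈ R → Yields R r.output u → Yields R s w → Yields R (.nonterminal r.input :: s) (u ++ w)

namespace Yields

variable {T N : Type} {R : Finset (ContextFreeRule T N)}

lemma append {s₁ s₂ : List (Symbol T N)} {w₁ w₂ : List T} (h₁ : Yields R s₁ w₁)
    (h₂ : Yields R s₂ w₂) : Yields R (s₁ ++ s₂) (w₁ ++ w₂) := by
  induction h₁ with
  | nil => exact h₂
  | terminal t _ ih => exact ih.terminal t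
  | nonterminal hr hu _ _ ih =>
    rw [List.append_assoc]
    exact .nonterminal hr hu ih

lemma exists_of_append {s₁ s₂ : List (Symbol T N)} {w : List T} (h : Yields R (s₁ ++ s₂) w) :
    ∃ w₁ w₂, w = w₁ ++ w₂ ∧ Yields R s₁ w₁ ∧ Yields R s₂ w₂ := by
  induction s₁ generalizing w with
  | nil => exact ⟨[], w, rfl, .nil, h⟩
  | cons a s₁ ih =>
    cases h with
    | terminal t h =>
      obtain ⟨w₁, w₂, rfl, h₁, h₂⟩ := ih h
      exact ⟨t :: w₁, w₂, rfl, h₁.terminal t, h₂⟩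
    | nonterminal hr hu h =>
      obtain ⟨w₁, w₂, rfl, h₁, h₂⟩ := ih h
      exact ⟨_, w₂, (List.append_assoc ..).symm, .nonterminal hr hu h₁, h₂⟩

lemma map_terminal (w : List T) : Yields R (w.map .terminal) w := by
  induction w with
  | nil => exact .nil
  | cons t w ih => exact ih.terminal t

lemma eq_of_map_terminal {v w : List T} (h : Yields R (v.map .terminal) w) : w = v := by
  induction v generalizing w with
  | nil => cases h; rfl
  | cons t v ih =>
    cases h with
    | terminal _ h => rw [ih h]

lemma map_terminal_iff {v w : List T} : Yields R (v.map .terminal) w ↔ w = v :=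
  ⟨eq_of_map_terminal, by rintro rfl; exact map_terminal _⟩

lemma singleton_iff {i : N} {w : List T} :
    Yields R [.nonterminal i] w ↔ ∃ r ∈ R, r.input = i ∧ Yields R r.output w := by
  constructor
  · intro h
    cases h with
    | nonterminal hr hu h => cases h; exact ⟨_, hr, rfl, by simpa using hu⟩
  · rintro ⟨r, hr, rfl, h⟩
    simpa using Yields.nonterminal hr h .nil

lemma of_rewrites {r : ContextFreeRule T N} (hr : r ∈ R) {u v : List (Symbol T N)} {w : List T}
    (h : r.Rewrites u v) (hv : Yields R v w) : Yields R u w := by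
  obtain ⟨p, q, rfl, rfl⟩ := h.exists_parts
  obtain ⟨w₁, w₃, rfl, h₁, h₃⟩ := hv.exists_of_append
  obtain ⟨w₁, w₂, rfl, h₁, h₂⟩ := h₁.exists_of_append
  exact (h₁.append (singleton_iff.2 ⟨r, hr, rfl, h₂⟩)).append h₃

lemma derives (i : N) {s : List (Symbol T N)} {w : List T} (h : Yields R s w) :
    (⟨N, i, R⟩ : ContextFreeGrammar T).Derives s (w.map .terminal) := by
  induction h with
  | nil => exact .refl _
  | terminal t _ ih => simpa using ih.append_left [.terminal t]
  | @nonterminal r s u w hr _ _ ihu ihw =>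
    rw [List.map_append]
    have h₁ : (⟨N, i, R⟩ : ContextFreeGrammar T).Produces (.nonterminal r.input :: s)
        (r.output ++ s) := ⟨r, hr, .head s⟩
    exact h₁.trans_derives ((ihu.append_right s).trans (ihw.append_left _))

lemma of_derives {i : N} {s : List (Symbol T N)} {w : List T}
    (h : (⟨N, i, R⟩ : ContextFreeGrammar T).Derives s (w.map .terminal)) : Yields R s w := by
  induction h using Relation.ReflTransGen.head_induction_on with
  | refl => exact map_terminal w
  | head h _ ih =>
    obtain ⟨r, hr, h⟩ := h
    exact of_rewrites hr h ih

lemma isContextFree (i : N) :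
    Language.IsContextFree ({w | Yields R [.nonterminal i] w} : Set (List T)) :=
  ⟨⟨N, i, R⟩, Set.ext fun _ => ⟨of_derives, derives i⟩⟩

end Yields

/-- Concatenation of two sets of words. -/
abbrev concat (U V : Set (List Bool)) : Set (List Bool) := Set.image2 (· ++ ·) U V

open Classical in
/-- There are context-free solutions of the system
`L₁ = A ∪ B L₁ L₁ ∪ R L₁`, `L₀ = C ∪ R L₀ ∪ B (L₀ ∪ L₁ L₀)`. -/
lemma exists_isContextFree_system (A B C R : Finset (List Bool)) :
    ∃ L₀ L₁ : Set (List Bool), Language.IsContextFree (L₀ : Language Bool) ∧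
      Language.IsContextFree (L₁ : Language Bool) ∧
      L₁ = concat A {[]} ∪ (concat B (concat L₁ L₁) ∪ concat R L₁) ∧
      L₀ = concat C {[]} ∪ (concat B (L₀ ∪ concat L₁ L₀) ∪ concat R L₀) := by
  let nt (i : Bool) : Symbol Bool Bool := .nonterminal i
  let rule (i : Bool) (s : List (Symbol Bool Bool)) (w : List Bool) : ContextFreeRule Bool Bool :=
    ⟨i, w.map .terminal ++ s⟩
  let rules : Finset (ContextFreeRule Bool Bool) :=
    A.image (rule true []) ∪ B.image (rule true ([nt true] ++ [nt true])) ∪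
      R.image (rule true [nt true]) ∪ C.image (rule false []) ∪ B.image (rule false [nt false]) ∪
      B.image (rule false ([nt true] ++ [nt false])) ∪ R.image (rule false [nt false])
  have hnil (w : List Bool) : Yields rules [] w ↔ w = [] :=
    Yields.map_terminal_iff (v := [])
  refine ⟨{w | Yields rules [nt false] w}, {w | Yields rules [nt true] w},
    Yields.isContextFree _, Yields.isContextFree _, ?_, ?_⟩
  · ext w
    rw [Set.mem_ofPred_eq, Yields.singleton_iff]
    simp only [rules, Finset.mem_union, Finset.mem_image, rule]
    constructor
    · rintro ⟨r, ((((((⟨v, hv, rfl⟩ | ⟨v, hv, rfl⟩) | ⟨v, hv, rfl⟩) | ⟨v, hv, rfl⟩) | ⟨v, hv, rfl⟩) |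
        ⟨v, hv, rfl⟩) | ⟨v, hv, rfl⟩), hi, h⟩ <;> simp only [reduceCtorEq] at hi <;>
        obtain ⟨w₁, w₂, rfl, h₁, h₂⟩ := h.exists_of_append <;> cases h₁.eq_of_map_terminal
      · exact .inl ⟨_, hv, _, (hnil _).1 h₂, rfl⟩
      · obtain ⟨w₃, w₄, rfl, h₃, h₄⟩ := h₂.exists_of_append
        exact .inr (.inl ⟨_, hv, _, ⟨_, h₃, _, h₄, rfl⟩, rfl⟩)
      · exact .inr (.inr ⟨_, hv, _, h₂, rfl⟩)
    · rintro (⟨v, hv, _, rfl, rfl⟩ | ⟨v, hv, _, ⟨_, h₃, _, h₄, rfl⟩, rfl⟩ | ⟨v, hv, _, h₂, rfl⟩)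
      · exact ⟨rule true [] v, by simp [rule]; grind, rfl, (Yields.map_terminal v).append .nil⟩
      · exact ⟨rule true ([nt true] ++ [nt true]) v, by simp [rule]; grind, rfl,
          (Yields.map_terminal v).append (h₃.append h₄)⟩
      · exact ⟨rule true [nt true] v, by simp [rule]; grind, rfl,
          (Yields.map_terminal v).append h₂⟩
  · ext w
    rw [Set.mem_ofPred_eq, Yields.singleton_iff]
    simp only [rules, Finset.mem_union, Finset.mem_image, rule]
    constructor
    · rintro ⟨r, ((((((⟨v, hv, rfl⟩ | ⟨v, hv, rfl⟩) | ⟨v, hv, rfl⟩) | ⟨v, hv, rfl⟩) | ⟨v, hv, rfl⟩) |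
        ⟨v, hv, rfl⟩) | ⟨v, hv, rfl⟩), hi, h⟩ <;> simp only [reduceCtorEq] at hi <;>
        obtain ⟨w₁, w₂, rfl, h₁, h₂⟩ := h.exists_of_append <;> cases h₁.eq_of_map_terminal
      · exact .inl ⟨_, hv, _, (hnil _).1 h₂, rfl⟩
      · exact .inr (.inl ⟨_, hv, _, .inl h₂, rfl⟩)
      · obtain ⟨w₃, w₄, rfl, h₃, h₄⟩ := h₂.exists_of_append
        exact .inr (.inl ⟨_, hv, _, .inr ⟨_, h₃, _, h₄, rfl⟩, rfl⟩)
      · exact .inr (.inr ⟨_, hv, _, h₂, rfl⟩)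
    · rintro (⟨v, hv, _, rfl, rfl⟩ | ⟨v, hv, _, h₂ | ⟨_, h₃, _, h₄, rfl⟩, rfl⟩ | ⟨v, hv, _, h₂, rfl⟩)
      · exact ⟨rule false [] v, by simp [rule]; grind, rfl, (Yields.map_terminal v).append .nil⟩
      · exact ⟨rule false [nt false] v, by simp [rule]; grind, rfl,
          (Yields.map_terminal v).append h₂⟩
      · exact ⟨rule false ([nt true] ++ [nt false]) v, by simp [rule]; grind, rfl,
          (Yields.map_terminal v).append (h₃.append h₄)⟩
      · exact ⟨rule false [nt false] v, by simp [rule]; grind, rfl,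
          (Yields.map_terminal v).append h₂⟩

/-- The words of a solution of the system over blocks of equal positive length are
pairwise incomparable for the prefix order, across both languages. -/
lemma eq_of_isPrefix_of_system {n : ℕ} (hn : 0 < n) {A B C R : Finset (List Bool)}
    (hlen : ∀ w ∈ A ∪ B ∪ C ∪ R, w.length = n) (hAB : Disjoint A B) (hAC : Disjoint A C)
    (hAR : Disjoint A R) (hBC : Disjoint B C) (hBR : Disjoint B R) (hCR : Disjoint C R)
    {L : Bool → Set (List Bool)}
    (h₁ : L true = concat A {[]} ∪ (concat B (concat (L true) (L true)) ∪ concat R (L true)))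
    (h₀ : L false = concat C {[]} ∪
      (concat B (L false ∪ concat (L true) (L false)) ∪ concat R (L false))) :
    ∀ (N : ℕ) (i j : Bool) (u v : List Bool), v.length < N → u ∈ L i → v ∈ L j → u <+: v →
      i = j ∧ u = v := by
  have key (i : Bool) (u : List Bool) (hu : u ∈ L i) : ∃ x t, u = x ++ t ∧ x.length = n ∧
      ((x ∈ A ∧ i = true ∧ t = []) ∨ (x ∈ C ∧ i = false ∧ t = []) ∨ (x ∈ R ∧ t ∈ L i) ∨
        (x ∈ B ∧ ((i = false ∧ t ∈ L false) ∨
          ∃ y z, t = y ++ z ∧ y ∈ L true ∧ z ∈ L i))) := by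
    cases i with
    | true =>
      rw [h₁] at hu
      rcases hu with ⟨x, hx, t, ht, rfl⟩ | ⟨x, hx, _, ⟨y, hy, z, hz, rfl⟩, rfl⟩ |
        ⟨x, hx, t, ht, rfl⟩
      · exact ⟨x, t, rfl, hlen x (by simp [Finset.mem_coe.1 hx]), .inl ⟨hx, rfl, ht⟩⟩
      · exact ⟨x, _, rfl, hlen x (by simp [Finset.mem_coe.1 hx]), .inr (.inr (.inr ⟨hx, .inr ⟨y, z, rfl, hy, hz⟩⟩))⟩
      · exact ⟨x, t, rfl, hlen x (by simp [Finset.mem_coe.1 hx]), .inr (.inr (.inl ⟨hx, ht⟩))⟩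
    | false =>
      rw [h₀] at hu
      rcases hu with ⟨x, hx, t, ht, rfl⟩ | ⟨x, hx, t, ht | ⟨y, hy, z, hz, rfl⟩, rfl⟩ |
        ⟨x, hx, t, ht, rfl⟩
      · exact ⟨x, t, rfl, hlen x (by simp [Finset.mem_coe.1 hx]), .inr (.inl ⟨hx, rfl, ht⟩)⟩
      · exact ⟨x, t, rfl, hlen x (by simp [Finset.mem_coe.1 hx]), .inr (.inr (.inr ⟨hx, .inl ⟨rfl, ht⟩⟩))⟩
      · exact ⟨x, _, rfl, hlen x (by simp [Finset.mem_coe.1 hx]), .inr (.inr (.inr ⟨hx, .inr ⟨y, z, rfl, hy, hz⟩⟩))⟩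
      · exact ⟨x, t, rfl, hlen x (by simp [Finset.mem_coe.1 hx]), .inr (.inr (.inl ⟨hx, ht⟩))⟩
  rw [Finset.disjoint_left] at hAB hAC hAR hBC hBR hCR
  intro N
  induction N with
  | zero => intro i j u v h; omega
  | succ N ih =>
    intro i j u v hv hui hvj huv
    obtain ⟨x, t, rfl, hx, hu⟩ := key i u hui
    obtain ⟨x', t', rfl, hx', hv'⟩ := key j v hvj
    obtain rfl : x = x' := List.prefix_of_prefix_length_le ((List.prefix_append x t).trans huv)
      (List.prefix_append x' t') (by omega) |>.eq_of_length (by omega)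
    rw [List.prefix_append_right_inj] at huv
    rw [List.length_append] at hv
    have htt := huv.length_le
    rcases hu with ⟨ha, rfl, rfl⟩ | ⟨hc, rfl, rfl⟩ | ⟨hr, ht⟩ | ⟨hb, hu⟩ <;>
    rcases hv' with ⟨ha', rfl, rfl⟩ | ⟨hc', rfl, rfl⟩ | ⟨hr', ht'⟩ | ⟨hb', hv'⟩ <;>
    first
    | (exfalso; grind)
    | exact ⟨rfl, rfl⟩
    | skip
    · obtain ⟨rfl, rfl⟩ := ih i j t t' (by omega) ht ht' huv
      exact ⟨rfl, rfl⟩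
    · rcases hu with ⟨rfl, hu⟩ | ⟨y, z, rfl, hy, hz⟩ <;>
      rcases hv' with ⟨rfl, hv'⟩ | ⟨y', z', rfl, hy', hz'⟩
      · obtain ⟨-, rfl⟩ := ih _ _ _ _ (by omega) hu hv' huv
        exact ⟨rfl, rfl⟩
      · simp only [List.length_append] at hv htt
        rcases List.prefix_or_prefix_of_prefix huv (List.prefix_append y' z') with h | h
        · simpa using (ih _ _ _ _ (by omega) hu hy' h).1
        · simpa using (ih _ _ _ _ (by omega) hy' hu h).1
      · simpa using (ih _ _ _ _ (by omega) hy hv' ((List.prefix_append y z).trans huv)).1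
      · simp only [List.length_append] at hv htt
        obtain rfl : y = y' := by
          rcases List.prefix_or_prefix_of_prefix ((List.prefix_append y z).trans huv)
            (List.prefix_append y' z') with h | h
          · exact (ih _ _ _ _ (by omega) hy hy' h).2
          · exact (ih _ _ _ _ (by omega) hy' hy h).2.symm
        obtain ⟨rfl, rfl⟩ := ih _ _ _ _ (by omega) hz hz'
          ((List.prefix_append_right_inj _).1 huv)
        exact ⟨rfl, rfl⟩

lemma wordProb_append (p : ℝ) (u v : List Bool) :
    wordProb p (u ++ v) = wordProb p u * wordProb p v := by
  simp only [wordProb, List.count_append, pow_add]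
  ring

lemma wordProb_nonneg {p : ℝ} (hp : p ∈ Set.Ioo (0 : ℝ) 1) (w : List Bool) : 0 ≤ wordProb p w := by
  have h₀ := hp.1
  have h₁ := sub_pos.2 hp.2
  unfold wordProb
  positivity

/-- The probability of a set of words as an extended nonnegative real. -/
noncomputable def mass (p : ℝ) (L : Set (List Bool)) : ENNReal :=
  ∑' w : L, ENNReal.ofReal (wordProb p w)

lemma toReal_mass {p : ℝ} (hp : p ∈ Set.Ioo (0 : ℝ) 1) (L : Set (List Bool)) :
    (mass p L).toReal = langProb p L := by
  rw [mass, ENNReal.tsum_toReal_eq (by simp), langProb]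
  exact tsum_congr fun w => ENNReal.toReal_ofReal (wordProb_nonneg hp _)

lemma mass_union (p : ℝ) {U V : Set (List Bool)} (h : Disjoint U V) :
    mass p (U ∪ V) = mass p U + mass p V :=
  ENNReal.summable.tsum_union_disjoint (f := fun w => ENNReal.ofReal (wordProb p w)) h
    ENNReal.summable

lemma mass_finset {p : ℝ} (hp : p ∈ Set.Ioo (0 : ℝ) 1) (F : Finset (List Bool)) :
    mass p F = ENNReal.ofReal (∑ w ∈ F, wordProb p w) := by
  rw [ENNReal.ofReal_sum_of_nonneg fun w _ => wordProb_nonneg hp w]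
  exact F.tsum_subtype fun w => ENNReal.ofReal (wordProb p w)

lemma mass_concat {p : ℝ} (hp : p ∈ Set.Ioo (0 : ℝ) 1) {U V : Set (List Bool)}
    (hU : PrefixFree U) : mass p (concat U V) = mass p U * mass p V := by
  have hinj : Set.InjOn (fun x : List Bool × List Bool => x.1 ++ x.2) (U ×ˢ V) := by
    rintro ⟨u, v⟩ ⟨hu, hv⟩ ⟨u', v'⟩ ⟨hu', hv'⟩ (h : u ++ v = u' ++ v')
    have huu : u = u' := by
      rcases List.prefix_or_prefix_of_prefix (List.prefix_append u v)
        (h ▸ List.prefix_append u' v') with h' | h'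
      · exact by_contra fun hne => hU u hu u' hu' hne h'
      · exact by_contra fun hne => hU u' hu' u hu (Ne.symm hne) h'
    subst huu
    rw [List.append_cancel_left h]
  rw [mass, concat, ← Set.image_prod,
    tsum_image (fun w => ENNReal.ofReal (wordProb p w)) hinj,
    ← (Equiv.Set.prod U V).symm.tsum_eq, ENNReal.tsum_prod', mass, mass, ← ENNReal.tsum_mul_right]
  refine tsum_congr fun u => ?_
  rw [← ENNReal.tsum_mul_left]
  refine tsum_congr fun v => ?_
  rw [← ENNReal.ofReal_mul (wordProb_nonneg hp _), ← wordProb_append]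
  rfl

lemma prefixFree_of_length {n : ℕ} {U : Set (List Bool)} (h : ∀ w ∈ U, w.length = n) :
    PrefixFree U := fun u hu v hv hne huv =>
  hne (huv.eq_of_length ((h u hu).trans (h v hv).symm))

lemma disjoint_concat {n : ℕ} {U U' V V' : Set (List Bool)} (h : Disjoint U U')
    (hU : ∀ w ∈ U, w.length = n) (hU' : ∀ w ∈ U', w.length = n) :
    Disjoint (concat U V) (concat U' V') := by
  rw [Set.disjoint_left]
  rintro _ ⟨u, hu, v, hv, rfl⟩ ⟨u', hu', v', hv', he⟩
  have := (List.append_inj he ((hU' u' hu').trans (hU u hu).symm)).1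
  exact Set.disjoint_left.1 h hu (this ▸ hu')

lemma mass_singleton_nil (p : ℝ) : mass p {[]} = 1 := by
  simp [mass, wordProb]

/-- **Kraft's inequality** for finite sets of words. -/
lemma sum_wordProb_le_one {p : ℝ} (hp : p ∈ Set.Ioo (0 : ℝ) 1) (N : ℕ) (F : Finset (List Bool))
    (hF : PrefixFree (F : Set (List Bool))) (hN : ∀ w ∈ F, w.length < N) :
    ∑ w ∈ F, wordProb p w ≤ 1 := by
  induction N generalizing F with
  | zero =>
    have : F = ∅ := Finset.eq_empty_of_forall_notMem fun w hw => by simpa using hN w hw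
    simp [this]
  | succ N ih =>
    by_cases hnil : [] ∈ F
    · have : F = {[]} := by
        refine Finset.eq_singleton_iff_unique_mem.2 ⟨hnil, fun w hw => ?_⟩
        exact by_contra fun hne => hF [] hnil w hw (Ne.symm hne) w.nil_prefix
      simp [this, wordProb]
    · have hcons (b : Bool) : Function.Injective (List.cons b) := List.cons_injective
      let G (b : Bool) : Finset (List Bool) := F.preimage (List.cons b) (hcons b).injOn
      have hG (b : Bool) : ∑ w ∈ G b, wordProb p w ≤ 1 := by
        refine ih (G b) (fun u hu v hv hne huv => ?_) (fun w hw => ?_)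
        · exact hF (b :: u) (by simpa [G] using hu) (b :: v) (by simpa [G] using hv)
            (by simpa using hne) (by simpa using huv)
        · simpa using hN (b :: w) (by simpa [G] using hw)
      have hFG : F = (G true).map ⟨_, hcons true⟩ ∪ (G false).map ⟨_, hcons false⟩ := by
        ext w
        rcases w with _ | ⟨_ | _, w⟩ <;> simp [G, hnil]
      have hdisj : Disjoint ((G true).map ⟨_, hcons true⟩) ((G false).map ⟨_, hcons false⟩) := by
        rw [Finset.disjoint_left]
        simp
      rw [hFG, Finset.sum_union hdisj, Finset.sum_map, Finset.sum_map]
      have h₁ (w : List Bool) : wordProb p (true :: w) = p * wordProb p w := by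
        simp [wordProb, pow_succ]; ring
      have h₀ (w : List Bool) : wordProb p (false :: w) = (1 - p) * wordProb p w := by
        simp [wordProb, pow_succ]; ring
      simp only [Function.Embedding.coeFn_mk, h₁, h₀, ← Finset.mul_sum]
      nlinarith [hG true, hG false, hp.1, hp.2]

lemma mass_le_one {p : ℝ} (hp : p ∈ Set.Ioo (0 : ℝ) 1) {L : Set (List Bool)}
    (hL : PrefixFree L) : mass p L ≤ 1 := by
  refine ENNReal.summable.tsum_le_of_sum_le fun s => ?_
  have h := sum_wordProb_le_one hp ((s.map (.subtype _)).sup List.length + 1) (s.map (.subtype _))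
    (fun u hu v hv => hL u (by simp at hu; exact hu.1) v (by simp at hv; exact hv.1))
    (fun w hw => Nat.lt_succ_of_le (Finset.le_sup (f := List.length) hw))
  rw [Finset.sum_map] at h
  rw [← ENNReal.ofReal_sum_of_nonneg fun w _ => wordProb_nonneg hp _]
  exact ENNReal.ofReal_le_one.2 h

/-- The values of a probability-bounded solution of the fixed-point equations. -/
lemma fixedPoint_values {a b c r x₀ x₁ g : ℝ} (hb : b = g * (2 * (b + c))) (hbc : 0 < b + c)
    (ha : a = b + c) (hsum : a + b + c + r = 1) (hg₀ : 0 < g) (hg₁ : g < 1 / 2)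
    (hx₁ : x₁ ≤ 1) (h₁ : x₁ = a + (b * (x₁ * x₁) + r * x₁))
    (h₀ : x₀ = c + (b * (x₀ + x₁ * x₀) + r * x₀)) :
    x₁ + x₀ = 1 ∧ x₁ = (1 - √(1 - 2 * g)) / (2 * g) := by
  have hr : r = 1 - 2 * (b + c) := by linarith
  have hc : c = (1 / 2 - g) * (2 * (b + c)) := by linarith
  have e₁ : x₁ = 1 / 2 + g * x₁ ^ 2 := by
    have : (2 * (b + c)) * (x₁ - (1 / 2 + g * x₁ ^ 2)) = 0 := by
      rw [hr, ha] at h₁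
      linear_combination h₁ + x₁ ^ 2 * hb
    rcases mul_eq_zero.1 this with h | h <;> linarith
  have e₀ : (x₁ + x₀ - 1) * (1 - g - g * x₁) = 0 := by
    have : (2 * (b + c)) * ((x₁ + x₀ - 1) * (1 - g - g * x₁)) = 0 := by
      rw [hr] at h₀
      linear_combination h₀ + (x₀ + x₁ * x₀ - 1) * hb + (2 * (b + c)) * e₁
    rcases mul_eq_zero.1 this with h | h <;> linarith
  refine ⟨?_, ?_⟩
  · rcases mul_eq_zero.1 e₀ with h | h
    · linarith
    · nlinarith
  · have hs : √(1 - 2 * g) = 1 - 2 * g * x₁ := by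
      rw [show 1 - 2 * g = (1 - 2 * g * x₁) ^ 2 by linear_combination 4 * g * e₁,
        Real.sqrt_sq (by nlinarith)]
    rw [hs]
    field_simp
    ring

lemma exists_words_card_eq_choose (n i : ℕ) : ∃ F : Finset (List Bool), F.card = n.choose i ∧
    ∀ w ∈ F, w.length = n ∧ w.count true = i := by
  induction n generalizing i with
  | zero =>
    cases i with
    | zero => exact ⟨{[]}, by simp⟩
    | succ i => exact ⟨∅, by simp⟩
  | succ n ih =>
    have hcons (b : Bool) : Function.Injective (List.cons b) := List.cons_injective
    obtain ⟨F, hF, hF'⟩ := ih i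
    cases i with
    | zero =>
      refine ⟨F.map ⟨_, hcons false⟩, by simpa using hF, fun w hw => ?_⟩
      obtain ⟨v, hv, rfl⟩ := Finset.mem_map.1 hw
      simp [hF' v hv]
    | succ i =>
      obtain ⟨G, hG, hG'⟩ := ih i
      refine ⟨G.map ⟨_, hcons true⟩ ∪ F.map ⟨_, hcons false⟩, ?_, fun w hw => ?_⟩
      · rw [Finset.card_union_of_disjoint, Finset.card_map, Finset.card_map, hF, hG,
          Nat.choose_succ_succ]
        rw [Finset.disjoint_left]
        simp
      · rcases Finset.mem_union.1 hw with hw | hw <;> obtain ⟨v, hv, rfl⟩ := Finset.mem_map.1 hw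
        · simp [hG' v hv]
        · simp [hF' v hv]

/-- The words of length `n` can be distributed to disjoint classes with prescribed numbers of
words of each weight. -/
lemma exists_disjoint_blocks {ι : Type*} [Fintype ι] (n : ℕ) (κ : ι → ℕ → ℕ)
    (hκ : ∀ i ≤ n, ∑ k, κ k i ≤ n.choose i) :
    ∃ D : ι → Finset (List Bool), (∀ k, ∀ w ∈ D k, w.length = n) ∧
      Pairwise (fun k l => Disjoint (D k) (D l)) ∧
      ∀ k (p : ℝ), ∑ w ∈ D k, wordProb p w =
        ∑ i ∈ Finset.range (n + 1), (κ k i : ℝ) * p ^ i * (1 - p) ^ (n - i) := by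
  have he (i : Fin (n + 1)) : ∃ e : (Σ k, Fin (κ k i)) ↪ List Bool,
      ∀ x, (e x).length = n ∧ (e x).count true = i := by
    obtain ⟨F, hF, hF'⟩ := exists_words_card_eq_choose n i
    have : Nonempty ((Σ k, Fin (κ k i)) ↪ F) := by
      refine Function.Embedding.nonempty_of_card_le ?_
      simpa [hF] using hκ i (Nat.lt_succ_iff.1 i.2)
    obtain ⟨e⟩ := this
    exact ⟨e.trans (.subtype _), fun x => hF' _ (e x).2⟩
  choose e he using he
  have hinj {i j : Fin (n + 1)} {x y} (h : e i x = e j y) : (⟨i, x⟩ : Σ i : Fin (n + 1), Σ k, Fin (κ k i)) =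
      ⟨j, y⟩ := by
    obtain rfl : i = j := Fin.ext (by rw [← (he i x).2, h, (he j y).2])
    rw [(e i).injective h]
  let f (k : ι) : (Σ i : Fin (n + 1), Fin (κ k i)) ↪ List Bool :=
    ⟨fun x => e x.1 ⟨k, x.2⟩, by
      rintro ⟨i, x⟩ ⟨j, y⟩ h
      have := hinj h
      simp only [Sigma.mk.injEq] at this
      obtain ⟨rfl, h⟩ := this
      simpa using h⟩
  refine ⟨fun k => Finset.univ.map (f k), fun k w hw => ?_, fun k l hkl => ?_, fun k p => ?_⟩
  · obtain ⟨x, -, rfl⟩ := Finset.mem_map.1 hw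
    exact (he _ _).1
  · refine Finset.disjoint_left.2 fun w hw hw' => ?_
    obtain ⟨⟨i, x⟩, -, rfl⟩ := Finset.mem_map.1 hw
    obtain ⟨⟨j, y⟩, -, h⟩ := Finset.mem_map.1 hw'
    have := hinj h
    simp only [Sigma.mk.injEq] at this
    obtain ⟨rfl, h⟩ := this
    simp only [heq_eq_eq, Sigma.mk.injEq] at h
    exact hkl h.1.symm
  · have hw (i : Fin (n + 1)) (x) : wordProb p (e i x) = p ^ (i : ℕ) * (1 - p) ^ (n - i) := by
      have h := List.count_true_add_count_false (e i x)
      rw [(he i x).1, (he i x).2] at h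
      rw [wordProb, (he i x).2, show (e i x).count false = n - i by omega]
    rw [Finset.sum_map, Fintype.sum_sigma, Finset.sum_range]
    refine Finset.sum_congr rfl fun i _ => ?_
    refine (Finset.sum_congr rfl fun j _ => hw i ⟨k, j⟩).trans ?_
    simp [mul_assoc]

open Polynomial

lemma abs_choose_div_choose_sub_pow_le {n j : ℕ} (hn : 0 < n) (hj : j ≤ n) {k : ℕ}
    (hk : 2 * k ≤ n) :
    |(j.choose k : ℝ) / n.choose k - ((j : ℝ) / n) ^ k| ≤ (k : ℝ) ^ 2 / n := by
  induction k with
  | zero => simp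
  | succ k ih =>
    specialize ih (by omega)
    have hn' : (0 : ℝ) < n := by exact_mod_cast hn
    have hj' : (j : ℝ) ≤ n := by exact_mod_cast hj
    have hkn : (2 : ℝ) * k ≤ n := by exact_mod_cast (by omega : 2 * k ≤ n)
    have hkn' : (0 : ℝ) < n - k := by linarith
    have hc : (0 : ℝ) < n.choose k := by exact_mod_cast Nat.choose_pos (by omega)
    have hc' : (0 : ℝ) < n.choose (k + 1) := by exact_mod_cast Nat.choose_pos (by omega)
    have hsucc {m : ℕ} : (m.choose (k + 1) : ℝ) * (k + 1) = m.choose k * (m - k) := by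
      rcases le_or_gt k m with h | h
      · have := Nat.choose_succ_right_eq m k
        rw [← Nat.cast_sub h]
        exact_mod_cast this
      · simp [Nat.choose_eq_zero_of_lt h, Nat.choose_eq_zero_of_lt (h.trans (Nat.lt_succ_self k))]
    have hr : (j.choose (k + 1) : ℝ) / n.choose (k + 1) =
        j.choose k / n.choose k * ((j - k) / (n - k)) := by
      rw [div_mul_div_comm, ← hsucc, ← hsucc, mul_div_mul_right _ _ (by positivity)]
    have hr₀ : (0 : ℝ) ≤ j.choose k / n.choose k := by positivity
    have hr₁ : (j.choose k : ℝ) / n.choose k ≤ 1 := by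
      rw [div_le_one hc]
      exact_mod_cast Nat.choose_le_choose k hj
    have ht₀ : (0 : ℝ) ≤ j / n := by positivity
    have ht₁ : (j : ℝ) / n ≤ 1 := (div_le_one hn').2 hj'
    have hQ : |((j : ℝ) - k) / (n - k) - j / n| ≤ 2 * k / n := by
      have : ((j : ℝ) - k) / (n - k) - j / n = - (k * (n - j) / (n * (n - k))) := by
        field_simp
        ring
      rw [this, abs_neg, abs_of_nonneg (div_nonneg (mul_nonneg (by positivity) (by linarith))
        (by positivity)), div_le_div_iff₀ (by positivity) hn']
      have hk0 : (0 : ℝ) ≤ k := by positivity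
      have hj0 : (0 : ℝ) ≤ j := by positivity
      nlinarith [mul_nonneg (mul_nonneg hk0 hn'.le) (by linarith : (0 : ℝ) ≤ n - 2 * k + j)]
    rw [hr]
    calc _ = |(j.choose k / n.choose k : ℝ) * (((j : ℝ) - k) / (n - k) - j / n) +
            j / n * (j.choose k / n.choose k - ((j : ℝ) / n) ^ k)| := by congr 1; ring
      _ ≤ _ := abs_add_le _ _
      _ ≤ 1 * (2 * k / n) + 1 * ((k : ℝ) ^ 2 / n) := by
        rw [abs_mul, abs_mul, abs_of_nonneg hr₀, abs_of_nonneg ht₀]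
        gcongr
      _ ≤ _ := by
        rw [one_mul, one_mul, ← add_div]
        gcongr
        push_cast
        linarith

lemma pow_eq_sum_bernstein {n k : ℕ} (hk : k ≤ n) (p : ℝ) :
    p ^ k = ∑ j ∈ Finset.range (n + 1),
      ((if k ≤ j then (n - k).choose (j - k) else 0 : ℕ) : ℝ) * p ^ j * (1 - p) ^ (n - j) := by
  have h := add_pow p (1 - p) (n - k)
  rw [add_sub_cancel, one_pow] at h
  trans p ^ k * ∑ i ∈ Finset.range (n - k + 1), p ^ i * (1 - p) ^ (n - k - i) * (n - k).choose i
  · rw [← h, mul_one]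
  rw [Finset.mul_sum]
  refine Finset.sum_of_injOn (· + k) (fun _ _ _ _ h => Nat.add_right_cancel h) ?_ ?_ ?_
  · intro i hi
    simp at hi ⊢
    omega
  · intro j hj hj'
    rw [if_neg]
    · simp
    · intro hkj
      refine hj' ⟨j - k, ?_, by simp; omega⟩
      simp at hj ⊢
      omega
  · intro i hi
    simp only [Finset.mem_range] at hi
    rw [if_pos (by omega), Nat.add_sub_cancel, show n - (i + k) = n - k - i by omega, pow_add]
    ring

/-- **Bernstein's theorem**: an integer polynomial that is positive on `[0, 1]` has nonnegative
integer coefficients in the unnormalized Bernstein bases of large degree. -/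
lemma exists_bernstein_of_pos_Icc {h : ℤ[X]} (hh : ∀ p ∈ Set.Icc (0 : ℝ) 1, 0 < aeval p h) :
    ∃ N, ∀ n ≥ N, ∃ b : ℕ → ℕ, ∀ p : ℝ, aeval p h =
      ∑ i ∈ Finset.range (n + 1), (b i : ℝ) * p ^ i * (1 - p) ^ (n - i) := by
  obtain ⟨x, hx, hmin⟩ := isCompact_Icc.exists_isMinOn (s := Set.Icc (0 : ℝ) 1) ⟨0, by simp⟩
    (f := fun p => aeval p h) (by fun_prop)
  set ε := aeval x h with hε
  have hεpos : 0 < ε := hh x hx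
  set d := h.natDegree
  obtain ⟨N, hN⟩ := exists_nat_ge ((∑ k ∈ Finset.range (d + 1), |(h.coeff k : ℝ)| * k ^ 2) / ε)
  refine ⟨N + 2 * d + 1, fun n hn => ?_⟩
  have hn0 : 0 < n := by omega
  have hn' : (0 : ℝ) < n := by exact_mod_cast hn0
  have heval (p : ℝ) : aeval p h = ∑ k ∈ Finset.range (d + 1), (h.coeff k : ℝ) * p ^ k := by
    rw [aeval_eq_sum_range]
    simp [d]
  let β (j : ℕ) : ℤ := ∑ k ∈ Finset.range (d + 1),
    h.coeff k * (if k ≤ j then (n - k).choose (j - k) else 0 : ℕ)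
  have hβ (j : ℕ) (hj : j ≤ n) : 0 ≤ β j := by
    have hβ' : (β j : ℝ) = n.choose j * ∑ k ∈ Finset.range (d + 1),
        (h.coeff k : ℝ) * (j.choose k / n.choose k) := by
      simp only [β, Int.cast_sum, Finset.mul_sum, Int.cast_mul, Int.cast_natCast]
      refine Finset.sum_congr rfl fun k hk => ?_
      rw [Finset.mem_range] at hk
      have hc : (n.choose k : ℝ) ≠ 0 := by exact_mod_cast (Nat.choose_pos (by omega)).ne'
      split_ifs with hkj
      · have := Nat.choose_mul (n := n) hkj
        have : (n.choose j : ℝ) * j.choose k = n.choose k * (n - k).choose (j - k) := by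
          exact_mod_cast this
        field_simp
        linear_combination (- (h.coeff k : ℝ)) * this
      · simp [Nat.choose_eq_zero_of_lt (not_le.1 hkj)]
    have ht : (j : ℝ) / n ∈ Set.Icc (0 : ℝ) 1 :=
      ⟨by positivity, (div_le_one hn').2 (by exact_mod_cast hj)⟩
    have hge : ε ≤ ∑ k ∈ Finset.range (d + 1), (h.coeff k : ℝ) * ((j : ℝ) / n) ^ k := by
      rw [← heval]
      exact hmin ht
    have hdiff : ∑ k ∈ Finset.range (d + 1), (h.coeff k : ℝ) * ((j : ℝ) / n) ^ k -
        ∑ k ∈ Finset.range (d + 1), (h.coeff k : ℝ) * (j.choose k / n.choose k) ≤ ε := by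
      rw [← Finset.sum_sub_distrib]
      calc _ ≤ ∑ k ∈ Finset.range (d + 1), |(h.coeff k : ℝ)| * k ^ 2 / n := by
            refine Finset.sum_le_sum fun k hk => (le_abs_self _).trans ?_
            rw [Finset.mem_range] at hk
            rw [← mul_sub, abs_mul, abs_sub_comm, mul_div_assoc]
            gcongr
            exact abs_choose_div_choose_sub_pow_le hn0 hj (by omega)
        _ ≤ ε := by
            rw [← Finset.sum_div, div_le_iff₀ hn', mul_comm, ← div_le_iff₀ hεpos]
            exact hN.trans (by exact_mod_cast (by omega : N ≤ n))
    have : (0 : ℝ) ≤ β j := by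
      rw [hβ']
      exact mul_nonneg (by positivity) (by linarith)
    exact_mod_cast this
  refine ⟨fun j => (β j).toNat, fun p => ?_⟩
  have hcast (j : ℕ) (hj : j ∈ Finset.range (n + 1)) : (((β j).toNat : ℕ) : ℝ) = ∑ k ∈
      Finset.range (d + 1), (h.coeff k : ℝ) *
        ((if k ≤ j then (n - k).choose (j - k) else 0 : ℕ) : ℝ) := by
    have h₁ : (((β j).toNat : ℤ) : ℝ) = β j := by
      rw [Int.toNat_of_nonneg (hβ j (by simpa [Nat.lt_succ_iff] using hj))]
    rw [Int.cast_natCast] at h₁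
    rw [h₁]
    simp only [β, Int.cast_sum, Int.cast_mul, Int.cast_natCast]
  symm
  rw [heval, Finset.sum_congr rfl fun j hj => by
    rw [hcast j hj, Finset.sum_mul, Finset.sum_mul], Finset.sum_comm]
  refine Finset.sum_congr rfl fun k hk => ?_
  rw [Finset.mem_range] at hk
  rw [pow_eq_sum_bernstein (show k ≤ n by omega) p, Finset.mul_sum]
  exact Finset.sum_congr rfl fun j _ => by ring

/-- Multiplying by `p ^ k * (1 - p) ^ l` shifts the coefficients in the unnormalized Bernstein
basis. -/
lemma pow_mul_pow_mul_sum_bernstein (n k l : ℕ) (b : ℕ → ℕ) (p : ℝ) :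
    p ^ k * (1 - p) ^ l * ∑ i ∈ Finset.range (n + 1), (b i : ℝ) * p ^ i * (1 - p) ^ (n - i) =
      ∑ i ∈ Finset.range (n + k + l + 1),
        ((if k ≤ i ∧ i ≤ n + k then b (i - k) else 0 : ℕ) : ℝ) * p ^ i *
          (1 - p) ^ (n + k + l - i) := by
  rw [Finset.mul_sum]
  refine Finset.sum_of_injOn (· + k) (fun _ _ _ _ h => Nat.add_right_cancel h) ?_ ?_ ?_
  · intro i hi
    simp at hi ⊢
    omega
  · intro j hj hj'
    rw [if_neg]
    · simp
    · intro hkj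
      refine hj' ⟨j - k, ?_, by simp; omega⟩
      simp
      omega
  · intro i hi
    simp only [Finset.mem_range] at hi
    rw [if_pos (by omega), Nat.add_sub_cancel, show n + k + l - (i + k) = n - i + l by omega,
      pow_add, pow_add]
    ring

lemma exists_factor_pos_Icc {q : ℤ[X]} (hq : ∀ p ∈ Set.Ioo (0 : ℝ) 1, 0 < aeval p q) :
    ∃ (k l : ℕ) (h : ℤ[X]), q = X ^ k * (1 - X) ^ l * h ∧
      ∀ p ∈ Set.Icc (0 : ℝ) 1, 0 < aeval p h := by
  have hq0 : q ≠ 0 := by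
    rintro rfl
    simpa using hq (1 / 2) (by norm_num)
  obtain ⟨q₁, h₁, hd₁⟩ := exists_eq_pow_rootMultiplicity_mul_and_not_dvd q hq0 0
  have hq₁ : q₁ ≠ 0 := by
    rintro rfl
    simp at hd₁
  obtain ⟨q₂, h₂, hd₂⟩ := exists_eq_pow_rootMultiplicity_mul_and_not_dvd q₁ hq₁ 1
  set k := q.rootMultiplicity 0
  set l := q₁.rootMultiplicity 1
  have hfac : q = X ^ k * (1 - X) ^ l * ((-1) ^ l * q₂) := by
    rw [h₁, h₂, map_zero, map_one, sub_zero]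
    have : ((1 : ℤ[X]) - X) ^ l * (-1) ^ l = (X - 1) ^ l := by
      rw [← mul_pow]
      ring
    linear_combination (- X ^ k * q₂) * this
  refine ⟨k, l, _, hfac, ?_⟩
  set h : ℤ[X] := (-1) ^ l * q₂ with hh
  have hIoo (p : ℝ) (hp : p ∈ Set.Ioo (0 : ℝ) 1) : 0 < aeval p h := by
    have := hq p hp
    rw [hfac] at this
    simp only [map_mul, map_pow, map_sub, map_one, aeval_X] at this
    exact pos_of_mul_pos_right this
      (mul_nonneg (pow_nonneg hp.1.le _) (pow_nonneg (sub_nonneg.2 hp.2.le) _))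
  have hne (z : ℤ) (hz : h.eval z ≠ 0) : aeval (z : ℝ) h ≠ 0 := by
    rw [← eq_intCast (algebraMap ℤ ℝ) z, aeval_algebraMap_apply]
    simpa [aeval_def] using hz
  have h0 : aeval (0 : ℝ) h ≠ 0 := by
    have := hne 0 ?_
    · simpa using this
    · intro hz
      refine hd₁ (dvd_iff_isRoot.2 ?_)
      simp only [hh, eval_mul, eval_pow, eval_neg, eval_one, mul_eq_zero] at hz
      rw [h₂, IsRoot, eval_mul, hz.resolve_left (by simp), mul_zero]
  have h1 : aeval (1 : ℝ) h ≠ 0 := by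
    have := hne 1 ?_
    · simpa using this
    · intro hz
      refine hd₂ (dvd_iff_isRoot.2 ?_)
      simp only [hh, eval_mul, eval_pow, eval_neg, eval_one, mul_eq_zero] at hz
      exact hz.resolve_left (by simp)
  have hcl (p : ℝ) (hp : p ∈ Set.Icc (0 : ℝ) 1) : 0 ≤ aeval p h := by
    rw [← closure_Ioo zero_ne_one] at hp
    exact closure_minimal (t := {p : ℝ | 0 ≤ aeval p h}) (fun x hx => (hIoo x hx).le)
      (isClosed_le (by fun_prop) (by fun_prop)) hp
  intro p hp
  refine lt_of_le_of_ne (hcl p hp) (Ne.symm ?_)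
  rcases eq_or_lt_of_le hp.1 with rfl | hp0
  · exact h0
  rcases eq_or_lt_of_le hp.2 with rfl | hp1
  · exact h1
  exact (hIoo p ⟨hp0, hp1⟩).ne'

lemma exists_bernstein_of_pos_Ioo {q : ℤ[X]} (hq : ∀ p ∈ Set.Ioo (0 : ℝ) 1, 0 < aeval p q) :
    ∃ N, ∀ n ≥ N, ∃ b : ℕ → ℕ, ∀ p : ℝ, aeval p q =
      ∑ i ∈ Finset.range (n + 1), (b i : ℝ) * p ^ i * (1 - p) ^ (n - i) := by
  obtain ⟨k, l, h, rfl, hh⟩ := exists_factor_pos_Icc hq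
  obtain ⟨N, hN⟩ := exists_bernstein_of_pos_Icc hh
  refine ⟨N + k + l, fun n hn => ?_⟩
  obtain ⟨b, hb⟩ := hN (n - k - l) (by omega)
  have hn' : n - k - l + k + l = n := by omega
  refine ⟨fun i => if k ≤ i ∧ i ≤ n - k - l + k then b (i - k) else 0, fun p => ?_⟩
  rw [map_mul, hb]
  simp only [map_mul, map_pow, map_sub, map_one, aeval_X]
  rw [pow_mul_pow_mul_sum_bernstein, hn']

/-- Two integer polynomials positive on `(0, 1)` become, after multiplication by a power of
`p * (1 - p)`, the weight enumerators of two small sets of words. -/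
lemma exists_bernstein_pair {q₁ q₂ : ℤ[X]} (h₁ : ∀ p ∈ Set.Ioo (0 : ℝ) 1, 0 < aeval p q₁)
    (h₂ : ∀ p ∈ Set.Ioo (0 : ℝ) 1, 0 < aeval p q₂) :
    ∃ (n k : ℕ) (b c : ℕ → ℕ), 0 < n ∧ (∀ i ≤ n, 2 * (b i + c i) ≤ n.choose i) ∧ ∀ p : ℝ,
      (p ^ k * (1 - p) ^ k * aeval p q₁ =
        ∑ i ∈ Finset.range (n + 1), (b i : ℝ) * p ^ i * (1 - p) ^ (n - i)) ∧
      (p ^ k * (1 - p) ^ k * aeval p q₂ =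
        ∑ i ∈ Finset.range (n + 1), (c i : ℝ) * p ^ i * (1 - p) ^ (n - i)) := by
  obtain ⟨N₁, hN₁⟩ := exists_bernstein_of_pos_Ioo h₁
  obtain ⟨N₂, hN₂⟩ := exists_bernstein_of_pos_Ioo h₂
  obtain ⟨b, hb⟩ := hN₁ (max N₁ N₂) (le_max_left _ _)
  obtain ⟨c, hc⟩ := hN₂ (max N₁ N₂) (le_max_right _ _)
  set m := max N₁ N₂
  set k := ∑ i ∈ Finset.range (m + 1), 2 * (b i + c i) + 1
  refine ⟨m + k + k, k, fun i => if k ≤ i ∧ i ≤ m + k then b (i - k) else 0,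
    fun i => if k ≤ i ∧ i ≤ m + k then c (i - k) else 0, by omega, fun i hi => ?_, fun p => ?_⟩
  · dsimp only
    split_ifs with hki
    · calc 2 * (b (i - k) + c (i - k)) ≤ ∑ i ∈ Finset.range (m + 1), 2 * (b i + c i) :=
            Finset.single_le_sum (f := fun i => 2 * (b i + c i)) (fun _ _ => Nat.zero_le _)
              (Finset.mem_range.2 (by omega))
        _ ≤ i + 1 := by omega
        _ = (i + 1).choose i := by simp
        _ ≤ _ := Nat.choose_le_choose i (by omega)
    · simp
  · rw [hb, hc, pow_mul_pow_mul_sum_bernstein, pow_mul_pow_mul_sum_bernstein]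
    exact ⟨rfl, rfl⟩

/-- Some nonzero integer multiple of a rational polynomial is an integer polynomial. -/
lemma exists_int_polynomial (g : ℚ[X]) : ∃ (K : ℤ) (h : ℤ[X]), K ≠ 0 ∧
    ∀ p : ℝ, aeval p h = K * aeval p g := by
  obtain ⟨K, hK₀, hK⟩ := IsLocalization.integerNormalization_spec (nonZeroDivisors ℤ) g
  refine ⟨K, IsLocalization.integerNormalization (nonZeroDivisors ℤ) g,
    nonZeroDivisors.ne_zero hK₀, fun p => ?_⟩
  rw [← aeval_map_algebraMap ℚ, hK]
  simp

/-- A distribution of blocks of tosses to three classes, with the expected probabilities up to a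
common factor, gives a pair of languages as required. -/
lemma exists_languages_of_blocks {n : ℕ} (hn : 0 < n) {A B C R : Finset (List Bool)}
    (hlen : ∀ w ∈ A ∪ B ∪ C ∪ R, w.length = n) (hAB : Disjoint A B) (hAC : Disjoint A C)
    (hAR : Disjoint A R) (hBC : Disjoint B C) (hBR : Disjoint B R) (hCR : Disjoint C R)
    (g : ℝ → ℝ)
    (hb : ∀ p ∈ Set.Ioo (0 : ℝ) 1, ∑ w ∈ B, wordProb p w =
      g p * (2 * (∑ w ∈ B, wordProb p w + ∑ w ∈ C, wordProb p w)))
    (hbc : ∀ p ∈ Set.Ioo (0 : ℝ) 1, 0 < ∑ w ∈ B, wordProb p w + ∑ w ∈ C, wordProb p w)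
    (ha : ∀ p ∈ Set.Ioo (0 : ℝ) 1, ∑ w ∈ A, wordProb p w =
      ∑ w ∈ B, wordProb p w + ∑ w ∈ C, wordProb p w)
    (hsum : ∀ p ∈ Set.Ioo (0 : ℝ) 1, ∑ w ∈ A, wordProb p w + ∑ w ∈ B, wordProb p w +
      ∑ w ∈ C, wordProb p w + ∑ w ∈ R, wordProb p w = 1)
    (hg : ∀ p ∈ Set.Ioo (0 : ℝ) 1, 0 < g p ∧ g p < 1 / 2) :
    ∃ L₀ L₁ : Set (List Bool),
      Language.IsContextFree (L₀ : Language Bool) ∧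
      Language.IsContextFree (L₁ : Language Bool) ∧
      Disjoint L₀ L₁ ∧ PrefixFree (L₀ ∪ L₁) ∧
      ∀ p ∈ Set.Ioo (0 : ℝ) 1, langProb p (L₀ ∪ L₁) = 1 ∧
        langProb p L₁ = (1 - √(1 - 2 * g p)) / (2 * g p) := by
  obtain ⟨L₀, L₁, hcf₀, hcf₁, h₁, h₀⟩ := exists_isContextFree_system A B C R
  let L (i : Bool) : Set (List Bool) := if i then L₁ else L₀
  have hL (i j : Bool) (u v : List Bool) := eq_of_isPrefix_of_system (L := L) hn hlen hAB hAC hAR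
    hBC hBR hCR h₁ h₀ (v.length + 1) i j u v (Nat.lt_succ_self _)
  have hdisj : Disjoint L₀ L₁ := Set.disjoint_left.2 fun u hu hu' => by
    simpa using (hL false true u u hu hu' (List.prefix_refl _)).1
  have hpf : PrefixFree (L₀ ∪ L₁) := by
    rintro u (hu | hu) v (hv | hv) hne huv
    · exact hne (hL false false u v hu hv huv).2
    · exact hne (hL false true u v hu hv huv).2
    · exact hne (hL true false u v hu hv huv).2
    · exact hne (hL true true u v hu hv huv).2
  have hpf₀ : PrefixFree L₀ := fun u hu v hv => hpf u (.inl hu) v (.inl hv)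
  have hpf₁ : PrefixFree L₁ := fun u hu v hv => hpf u (.inr hu) v (.inr hv)
  refine ⟨L₀, L₁, hcf₀, hcf₁, hdisj, hpf, fun p hp => ?_⟩
  have hlA : ∀ w ∈ (A : Set (List Bool)), w.length = n := fun w hw =>
    hlen w (by simp [Finset.mem_coe.1 hw])
  have hlB : ∀ w ∈ (B : Set (List Bool)), w.length = n := fun w hw =>
    hlen w (by simp [Finset.mem_coe.1 hw])
  have hlC : ∀ w ∈ (C : Set (List Bool)), w.length = n := fun w hw =>
    hlen w (by simp [Finset.mem_coe.1 hw])
  have hlR : ∀ w ∈ (R : Set (List Bool)), w.length = n := fun w hw =>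
    hlen w (by simp [Finset.mem_coe.1 hw])
  have hdLL : Disjoint L₀ (concat L₁ L₀) := Set.disjoint_left.2 fun u hu => by
    rintro ⟨y, hy, z, hz, rfl⟩
    simpa using (hL true false y _ hy hu (List.prefix_append y z)).1
  have htop {U : Set (List Bool)} (hU : PrefixFree U) : mass p U ≠ ⊤ :=
    ((mass_le_one hp hU).trans_lt ENNReal.one_lt_top).ne
  have hnn (F : Finset (List Bool)) : 0 ≤ ∑ w ∈ F, wordProb p w :=
    Finset.sum_nonneg fun w _ => wordProb_nonneg hp w
  have hm₁ : mass p L₁ = mass p A * 1 + (mass p B * (mass p L₁ * mass p L₁) +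
      mass p R * mass p L₁) := by
    conv_lhs => rw [h₁]
    rw [mass_union p (Set.disjoint_union_right.2
        ⟨disjoint_concat (Finset.disjoint_coe.2 hAB) hlA hlB,
          disjoint_concat (Finset.disjoint_coe.2 hAR) hlA hlR⟩),
      mass_union p (disjoint_concat (Finset.disjoint_coe.2 hBR) hlB hlR),
      mass_concat hp (prefixFree_of_length hlA), mass_concat hp (prefixFree_of_length hlB),
      mass_concat hp (prefixFree_of_length hlR), mass_concat hp hpf₁, mass_singleton_nil]
  have hm₀ : mass p L₀ = mass p C * 1 + (mass p B * (mass p L₀ + mass p L₁ * mass p L₀) +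
      mass p R * mass p L₀) := by
    conv_lhs => rw [h₀]
    rw [mass_union p (Set.disjoint_union_right.2
        ⟨disjoint_concat (Finset.disjoint_coe.2 hBC.symm) hlC hlB,
          disjoint_concat (Finset.disjoint_coe.2 hCR) hlC hlR⟩),
      mass_union p (disjoint_concat (Finset.disjoint_coe.2 hBR) hlB hlR),
      mass_concat hp (prefixFree_of_length hlC), mass_concat hp (prefixFree_of_length hlB),
      mass_concat hp (prefixFree_of_length hlR), mass_union p hdLL, mass_concat hp hpf₁,
      mass_singleton_nil]
  have e₁ := toReal_mass hp L₁
  have e₀ := toReal_mass hp L₀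
  lift mass p L₁ to NNReal using htop hpf₁ with x₁ hx₁
  lift mass p L₀ to NNReal using htop hpf₀ with x₀ hx₀
  simp only [mass_finset hp, ENNReal.ofReal] at hm₀ hm₁
  norm_cast at hm₀ hm₁
  rw [← NNReal.coe_inj] at hm₀ hm₁
  simp only [NNReal.coe_add, NNReal.coe_mul, mul_one,
    Real.coe_toNNReal _ (hnn _)] at hm₀ hm₁
  have hle : (x₁ : ℝ) ≤ 1 := by
    have := mass_le_one hp hpf₁
    rw [← hx₁] at this
    exact_mod_cast this
  have hval := fixedPoint_values (hb p hp) (hbc p hp) (ha p hp) (hsum p hp) (hg p hp).1 (hg p hp).2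
    hle hm₁ hm₀
  rw [← e₁, ← toReal_mass hp, mass_union p hdisj, ← hx₁, ← hx₀]
  refine ⟨?_, hval.2⟩
  rw [← ENNReal.coe_add, ENNReal.coe_toReal, NNReal.coe_add, add_comm, hval.1]

theorem stmt_15 (g₁ g₂ : Polynomial ℚ)
    (hg : ∀ p ∈ Set.Ioo (0:ℝ) 1, Polynomial.aeval p g₂ ≠ 0 ∧
      0 < Polynomial.aeval p g₁ / Polynomial.aeval p g₂ ∧
      Polynomial.aeval p g₁ / Polynomial.aeval p g₂ < 1 / 2) :
    ∃ L₀ L₁ : Set (List Bool),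
      Language.IsContextFree (L₀ : Language Bool) ∧
      Language.IsContextFree (L₁ : Language Bool) ∧
      Disjoint L₀ L₁ ∧
      PrefixFree (L₀ ∪ L₁) ∧
      ∀ p ∈ Set.Ioo (0:ℝ) 1,
        langProb p (L₀ ∪ L₁) = 1 ∧
        langProb p L₁ =
          (1 - Real.sqrt (1 - 2 * (Polynomial.aeval p g₁ / Polynomial.aeval p g₂))) /
          (2 * (Polynomial.aeval p g₁ / Polynomial.aeval p g₂)) := by
  obtain ⟨K₁, k₁, hK₁, hk₁⟩ := exists_int_polynomial g₁
  obtain ⟨K₂, k₂, hK₂, hk₂⟩ := exists_int_polynomial g₂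
  have hK₁' : (K₁ : ℝ) ≠ 0 := by exact_mod_cast hK₁
  have hK₂' : (K₂ : ℝ) ≠ 0 := by exact_mod_cast hK₂
  set g : ℝ → ℝ := fun p => Polynomial.aeval p g₁ / Polynomial.aeval p g₂ with hgdef
  set d : ℤ[X] := (C K₁ * k₂) ^ 2 with hd
  set q₁ : ℤ[X] := 2 * (C K₂ * k₁) * (C K₁ * k₂) with hq₁
  have hdpos : ∀ p ∈ Set.Ioo (0 : ℝ) 1, 0 < aeval p d := fun p hp => by
    have := (hg p hp).1
    simp only [hd, map_pow, map_mul, eq_intCast, map_intCast, hk₂]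
    positivity
  have hq₁d : ∀ p ∈ Set.Ioo (0 : ℝ) 1, aeval p q₁ = 2 * g p * aeval p d := fun p hp => by
    have := (hg p hp).1
    simp only [hd, hq₁, hgdef, map_pow, map_mul, eq_intCast, map_intCast, hk₂, hk₁, map_ofNat]
    field_simp
  obtain ⟨n, k, b, c, hn, hbound, hbc⟩ := exists_bernstein_pair (q₁ := q₁) (q₂ := d - q₁)
    (fun p hp => by
      rw [hq₁d p hp]
      exact mul_pos (mul_pos two_pos (hg p hp).2.1) (hdpos p hp))
    (fun p hp => by
      rw [map_sub, hq₁d p hp]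
      have := (hg p hp).2.2
      have : 0 < (1 - 2 * g p) * aeval p d := mul_pos (by simp only [hgdef]; linarith) (hdpos p hp)
      linarith)
  obtain ⟨D, hDlen, hDdisj, hD⟩ := exists_disjoint_blocks n
    ![fun i => b i + c i, b, c, fun i => n.choose i - 2 * (b i + c i)] (fun i hi => by
      have := hbound i hi
      simp only [Fin.sum_univ_four, Matrix.cons_val]
      omega)
  have hA := hD 0
  have hB := hD 1
  have hC := hD 2
  have hR := hD 3
  simp only [Matrix.cons_val] at hA hB hC hR
  have hA' (p : ℝ) : ∑ w ∈ D 0, wordProb p w =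
      ∑ w ∈ D 1, wordProb p w + ∑ w ∈ D 2, wordProb p w := by
    rw [hA, hB, hC, ← Finset.sum_add_distrib]
    refine Finset.sum_congr rfl fun i _ => ?_
    push_cast
    ring
  have hsum (p : ℝ) : ∑ w ∈ D 0, wordProb p w + ∑ w ∈ D 1, wordProb p w +
      ∑ w ∈ D 2, wordProb p w + ∑ w ∈ D 3, wordProb p w = 1 := by
    have h := add_pow p (1 - p) n
    rw [add_sub_cancel, one_pow] at h
    rw [h, hA, hB, hC, hR, ← Finset.sum_add_distrib, ← Finset.sum_add_distrib,
      ← Finset.sum_add_distrib]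
    refine Finset.sum_congr rfl fun i hi => ?_
    rw [Nat.cast_sub (hbound i (Nat.lt_succ_iff.1 (Finset.mem_range.1 hi)))]
    push_cast
    ring
  refine exists_languages_of_blocks hn (A := D 0) (B := D 1) (C := D 2) (R := D 3) (fun w hw => ?_)
    (hDdisj (by decide)) (hDdisj (by decide)) (hDdisj (by decide)) (hDdisj (by decide))
    (hDdisj (by decide)) (hDdisj (by decide)) g (fun p hp => ?_) (fun p hp => ?_)
    (fun p _ => hA' p) (fun p _ => hsum p) (fun p hp => (hg p hp).2)
  · simp only [Finset.mem_union] at hw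
    rcases hw with ((hw | hw) | hw) | hw <;> exact hDlen _ w hw
  · rw [hB, hC, ← (hbc p).1, ← (hbc p).2, map_sub, hq₁d p hp]
    ring
  · rw [hB, hC, ← (hbc p).1, ← (hbc p).2, ← mul_add, map_sub, add_sub_cancel]
    exact mul_pos (mul_pos (pow_pos hp.1 _) (pow_pos (sub_pos.2 hp.2) _)) (hdpos p hp)
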